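/- arXiv:2411.16913 — 2 statements merged into one kernel-verified Lean document; each statement's English description precedes it below -/
import Mathlib

section
/- For every λ > 0, the maximal Poisson probability satisfies ⨆ i, p_i(λ) = e^{-λ}·λ^{⌊λ⌋}/⌊λ⌋!. Moreover, for every λ ≥ 1 one has ⨆ i, p_i(λ) < 1/√(2π·⌊λ⌋), and for every λ > 1 one has ⨆ i, p_i(λ) < (1/√(2πλ)) · (1 + 1/max(λ-1, 1))^{1/2} · exp(-1/(12λ+1)). Here ⌊λ⌋ denotes the integer part of λ. -/
open Real Filter Topology

/-- The Poisson probabilities `p_i(λ) = e^{-λ} λ^i / i!`. -/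
noncomputable def poissonP (l : ℝ) (i : ℕ) : ℝ :=
  Real.exp (-l) * l ^ i / (Nat.factorial i)

/-- `ψ(α,λ) = ∑_{i=0}^∞ (p_i(λ))^α`. -/
noncomputable def psiPoisson (α l : ℝ) : ℝ :=
  ∑' i, (poissonP l i) ^ α

theorem poissonP_nonneg {l : ℝ} (hl : 0 ≤ l) (i : ℕ) : 0 ≤ poissonP l i := by
  unfold poissonP
  positivity

theorem poissonP_succ (l : ℝ) (i : ℕ) : poissonP l (i + 1) = poissonP l i * (l / (i + 1)) := by
  have : ((Nat.factorial i : ℕ) : ℝ) ≠ 0 := by positivity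
  have : (i + 1 : ℝ) ≠ 0 := by positivity
  simp only [poissonP, Nat.factorial_succ, pow_succ]
  push_cast
  field_simp

/-- The Poisson probabilities are maximal at the integer part of the parameter. -/
theorem poissonP_le_floor {l : ℝ} (hl : 0 < l) (i : ℕ) : poissonP l i ≤ poissonP l ⌊l⌋₊ := by
  rcases le_total i ⌊l⌋₊ with hi | hi
  · induction hi using Nat.decreasingInduction with
    | self => exact le_rfl
    | of_succ k hk ih =>
      refine le_trans ?_ ih
      rw [poissonP_succ]
      refine le_mul_of_one_le_right (poissonP_nonneg hl.le k) ?_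
      rw [one_le_div (by positivity)]
      exact_mod_cast (Nat.le_floor_iff hl.le).mp hk
  · induction i, hi using Nat.le_induction with
    | base => exact le_rfl
    | succ k hk ih =>
      refine le_trans ?_ ih
      rw [poissonP_succ]
      refine mul_le_of_le_one_right (poissonP_nonneg hl.le k) ?_
      rw [div_le_one (by positivity)]
      have : (⌊l⌋₊ : ℝ) ≤ k := by exact_mod_cast hk
      linarith [Nat.lt_floor_add_one l]

theorem iSup_poissonP {l : ℝ} (hl : 0 < l) : ⨆ i, poissonP l i = poissonP l ⌊l⌋₊ :=
  le_antisymm (ciSup_le (poissonP_le_floor hl))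
    (le_ciSup ⟨_, Set.forall_mem_range.mpr (poissonP_le_floor hl)⟩ _)

/-- The lower counterpart of `Stirling.log_stirlingSeq_sdiff_le`. -/
theorem le_log_stirlingSeq_sdiff (n : ℕ) :
    1 / (12 * (n + 1 : ℝ) + 1) - 1 / (12 * (n + 2 : ℝ) + 1) ≤
      log (Stirling.stirlingSeq (n + 1)) - log (Stirling.stirlingSeq (n + 2)) := by
  set r : ℝ := (1 / (2 * (n + 1) + 1)) ^ 2 / 3 with hr
  have hr0 : 0 ≤ r := by positivity
  have hr_eq : r = 1 / (3 * (2 * (n + 1) + 1) ^ 2) := by rw [hr]; field_simp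
  have hr1 : r < 1 := by
    rw [hr_eq, div_lt_one (by positivity)]
    nlinarith [(Nat.cast_nonneg n : (0 : ℝ) ≤ n)]
  have hgeom : HasSum (fun k : ℕ => r ^ (k + 1)) (r * (1 - r)⁻¹) := by
    simpa only [pow_succ'] using (hasSum_geometric_of_lt_one hr0 hr1).mul_left r
  refine le_trans ?_ (hasSum_le (fun k => ?_) hgeom (Stirling.log_stirlingSeq_sdiff_hasSum n))
  · have hn : (0 : ℝ) ≤ n := Nat.cast_nonneg n
    have hd : (0 : ℝ) < 3 * (2 * (n + 1) + 1) ^ 2 - 1 := by nlinarith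
    have hsum : r * (1 - r)⁻¹ = 1 / (3 * (2 * (n + 1) + 1) ^ 2 - 1) := by
      rw [hr_eq, one_sub_div (by positivity), inv_div]
      exact div_mul_div_cancel₀ (by positivity)
    rw [hsum, div_sub_div _ _ (by positivity) (by positivity),
      div_le_div_iff₀ (by positivity) hd]
    nlinarith
  · rw [hr, div_pow, div_eq_inv_mul, Nat.cast_add_one, one_div (2 * ((k : ℝ) + 1) + 1)]
    push_cast
    gcongr
    have := one_add_mul_le_pow (show (-2 : ℝ) ≤ 2 by norm_num) (k + 1)
    push_cast at this
    norm_num at this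
    linarith

/-- Robbins' lower bound for the Stirling sequence. -/
theorem sqrt_pi_mul_exp_le_stirlingSeq {n : ℕ} (hn : n ≠ 0) :
    √π * exp (1 / (12 * n + 1)) ≤ Stirling.stirlingSeq n := by
  obtain ⟨n, rfl⟩ := Nat.exists_eq_succ_of_ne_zero hn
  let f : ℕ → ℝ := fun k => log (Stirling.stirlingSeq (k + 1)) - 1 / (12 * (k + 1 : ℝ) + 1)
  have hf : Antitone f := antitone_nat_of_succ_le fun k => by
    have := le_log_stirlingSeq_sdiff k
    simp only [f]
    push_cast
    rw [show (k : ℝ) + 1 + 1 = k + 2 by ring]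
    linarith
  have hlim : Tendsto f atTop (𝓝 (log √π - 0)) := by
    refine Tendsto.sub ?_ ?_
    · exact (Stirling.tendsto_stirlingSeq_sqrt_pi.comp (tendsto_add_atTop_nat 1)).log
        (by positivity)
    · refine tendsto_const_nhds.div_atTop (tendsto_atTop_add_const_right _ _ ?_)
      exact (tendsto_atTop_add_const_right _ _ tendsto_natCast_atTop_atTop).const_mul_atTop
        (by norm_num)
  have h := hf.le_of_tendsto hlim n
  rw [← log_le_log_iff (by positivity) (Stirling.stirlingSeq'_pos n),
    log_mul (by positivity) (by positivity), log_exp]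
  simp only [f] at h
  push_cast
  linarith

/-- Robbins' lower bound for the factorial. -/
theorem robbins_le_factorial {n : ℕ} (hn : n ≠ 0) :
    √(2 * π * n) * (n / exp 1) ^ n * exp (1 / (12 * n + 1)) ≤ n.factorial := by
  have h := sqrt_pi_mul_exp_le_stirlingSeq hn
  rw [Stirling.stirlingSeq, le_div_iff₀ (by positivity)] at h
  refine le_trans (le_of_eq ?_) h
  rw [show 2 * π * (n : ℝ) = π * (2 * n) by ring, sqrt_mul pi_pos.le]
  ring

/-- The function `x ↦ exp (-x) * x ^ n` is at most its value at `n`. -/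
theorem exp_neg_mul_pow_le {x : ℝ} (hx : 0 ≤ x) (n : ℕ) :
    exp (-x) * x ^ n ≤ ((n : ℝ) / exp 1) ^ n := by
  rcases eq_or_ne n 0 with rfl | hn
  · simpa using hx
  have hn' : (0 : ℝ) < n := by positivity
  have h : x ≤ n * exp (x / n - 1) := by
    have := add_one_le_exp (x / n - 1)
    rwa [sub_add_cancel, div_le_iff₀' hn'] at this
  calc exp (-x) * x ^ n ≤ exp (-x) * (n * exp (x / n - 1)) ^ n := by gcongr
    _ = (n : ℝ) ^ n * (exp (-x) * exp (n * (x / n - 1))) := by rw [mul_pow, ← exp_nat_mul]; ring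
    _ = ((n : ℝ) / exp 1) ^ n := by
      rw [div_pow, ← exp_nat_mul, ← exp_add, div_eq_mul_inv _ (exp _), ← exp_neg]
      congr 2
      field_simp
      ring

theorem poissonP_le_robbins {l : ℝ} (hl : 0 ≤ l) {n : ℕ} (hn : n ≠ 0) :
    poissonP l n ≤ 1 / √(2 * π * n) * exp (-(1 / (12 * n + 1))) := by
  have hn' : (0 : ℝ) < n := by positivity
  rw [poissonP, div_le_iff₀ (by positivity)]
  calc exp (-l) * l ^ n ≤ ((n : ℝ) / exp 1) ^ n := exp_neg_mul_pow_le hl n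
    _ = 1 / √(2 * π * n) * exp (-(1 / (12 * n + 1))) *
        (√(2 * π * n) * (n / exp 1) ^ n * exp (1 / (12 * n + 1))) := by
      rw [exp_neg]
      field_simp
    _ ≤ _ := by
      gcongr
      exact robbins_le_factorial hn

theorem one_div_sqrt_floor_lt {l : ℝ} (hl : 1 < l) :
    1 / √(2 * π * ⌊l⌋₊) <
      1 / √(2 * π * l) * (1 + 1 / max (l - 1) 1) ^ ((1 : ℝ) / 2) := by
  have hn : (1 : ℝ) ≤ ⌊l⌋₊ := by exact_mod_cast Nat.one_le_floor_iff l |>.mpr hl.le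
  have hn0 : (0 : ℝ) < ⌊l⌋₊ := by linarith
  have hl0 : 0 < l := by linarith
  have hlt := Nat.lt_floor_add_one l
  have hm : max (l - 1) 1 ≤ ⌊l⌋₊ := max_le (by linarith) hn
  have hm0 : 0 < max (l - 1) 1 := lt_max_of_lt_right one_pos
  have key : l / ⌊l⌋₊ < 1 + 1 / max (l - 1) 1 := by
    calc l / ⌊l⌋₊ < (⌊l⌋₊ + 1) / ⌊l⌋₊ := by gcongr
      _ = 1 + 1 / (⌊l⌋₊ : ℝ) := by rw [add_div, div_self hn0.ne']
      _ ≤ _ := by gcongr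
  rw [← sqrt_eq_rpow]
  calc 1 / √(2 * π * ⌊l⌋₊) = 1 / √(2 * π * l) * √(l / ⌊l⌋₊) := by
        rw [sqrt_mul (by positivity), sqrt_mul (by positivity) l, sqrt_div hl0.le]
        field_simp
    _ < _ := by gcongr

/-- the maximal Poisson probability and its bounds. -/
theorem poisson_max_probability :
    (∀ l : ℝ, 0 < l →
      (⨆ i, poissonP l i) =
        Real.exp (-l) * l ^ (Nat.floor l) / (Nat.factorial (Nat.floor l))) ∧
    (∀ l : ℝ, 1 ≤ l →
      (⨆ i, poissonP l i) < 1 / Real.sqrt (2 * Real.pi * (Nat.floor l : ℝ))) ∧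
    (∀ l : ℝ, 1 < l →
      (⨆ i, poissonP l i) <
        (1 / Real.sqrt (2 * Real.pi * l)) * (1 + 1 / max (l - 1) 1) ^ ((1 : ℝ) / 2) *
          Real.exp (-(1 / (12 * l + 1)))) := by
  refine ⟨fun l hl => iSup_poissonP hl, fun l hl => ?_, fun l hl => ?_⟩
  · have hn : ⌊l⌋₊ ≠ 0 := (Nat.floor_pos.mpr hl).ne'
    rw [iSup_poissonP (by linarith)]
    refine (poissonP_le_robbins (by linarith) hn).trans_lt ?_
    refine mul_lt_of_lt_one_right (by positivity) (exp_lt_one_iff.mpr (neg_lt_zero.mpr (by positivity)))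
  · have hn : ⌊l⌋₊ ≠ 0 := (Nat.floor_pos.mpr hl.le).ne'
    have hl0 : 0 < l := by linarith
    rw [iSup_poissonP hl0]
    calc poissonP l ⌊l⌋₊ ≤ 1 / √(2 * π * ⌊l⌋₊) * exp (-(1 / (12 * ⌊l⌋₊ + 1))) :=
          poissonP_le_robbins hl0.le hn
      _ ≤ 1 / √(2 * π * ⌊l⌋₊) * exp (-(1 / (12 * l + 1))) := by
          gcongr
          exact Nat.floor_le hl0.le
      _ < _ := mul_lt_mul_of_pos_right (one_div_sqrt_floor_lt hl) (exp_pos _)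
end

section
/- There exist real numbers a, b with 0 < a < b < 1 such that for every α ∈ (a, b) there exists δ > 0 with δ < 1 such that the one-parameter generalized Rényi entropy of the Poisson distribution, λ ↦ H_GR(α,λ), is strictly decreasing on the interval (1-δ, 1+δ). -/
open Real Filter Topology

theorem log_factorial_nonneg (i : ℕ) : 0 ≤ Real.log (i.factorial : ℝ) :=
  Real.log_nonneg (by exact_mod_cast i.factorial_pos)

theorem log_factorial_le_sq (i : ℕ) : Real.log (i.factorial : ℝ) ≤ (i : ℝ) ^ 2 := by
  rcases Nat.eq_zero_or_pos i with rfl | hi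
  · simp
  have h1 : (i.factorial : ℝ) ≤ (i : ℝ) ^ i := by exact_mod_cast i.factorial_le_pow
  have h2 := Real.log_le_log (by positivity) h1
  rw [Real.log_pow] at h2
  have h3 := Real.log_le_self (Nat.cast_nonneg (α := ℝ) i)
  nlinarith [Nat.cast_nonneg (α := ℝ) i]

theorem natCast_le_two_pow (i : ℕ) : (i : ℝ) ≤ 2 ^ i := by
  exact_mod_cast i.lt_two_pow_self.le

theorem natCast_mul_log_factorial_le (i : ℕ) :
    (i : ℝ) * Real.log (i.factorial : ℝ) ≤ 8 ^ i := by
  calc (i : ℝ) * Real.log (i.factorial : ℝ) ≤ i * (i : ℝ) ^ 2 := by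
        gcongr; exact log_factorial_le_sq i
    _ = (i : ℝ) ^ 3 := by ring
    _ ≤ ((2 : ℝ) ^ i) ^ 3 := by gcongr; exact natCast_le_two_pow i
    _ = 8 ^ i := by rw [← pow_mul, mul_comm, pow_mul]; norm_num

theorem log_factorial_le_eight_pow (i : ℕ) : Real.log (i.factorial : ℝ) ≤ 8 ^ i := by
  rcases Nat.eq_zero_or_pos i with rfl | hi
  · simp
  refine le_trans ?_ (natCast_mul_log_factorial_le i)
  have : (1 : ℝ) ≤ i := by exact_mod_cast hi
  nlinarith [log_factorial_nonneg i]

theorem natCast_le_eight_pow (i : ℕ) : (i : ℝ) ≤ 8 ^ i :=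
  (natCast_le_two_pow i).trans (by gcongr; norm_num)

theorem abs_one_le_eight_pow (i : ℕ) : |(1 : ℕ → ℝ) i| ≤ 8 ^ i := by
  simpa using one_le_pow₀ (by norm_num)

theorem abs_natCast_le_eight_pow (i : ℕ) : |(i : ℝ)| ≤ 8 ^ i := by
  simpa using natCast_le_eight_pow i

theorem abs_log_factorial_le_eight_pow (i : ℕ) : |Real.log (i.factorial : ℝ)| ≤ 8 ^ i := by
  rw [abs_of_nonneg (log_factorial_nonneg i)]
  exact log_factorial_le_eight_pow i

theorem abs_natCast_mul_log_factorial_le_eight_pow (i : ℕ) :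
    |(i : ℝ) * Real.log (i.factorial : ℝ)| ≤ 8 ^ i := by
  rw [abs_of_nonneg (mul_nonneg i.cast_nonneg (log_factorial_nonneg i))]
  exact natCast_mul_log_factorial_le i

/-- The weights `(i!)^{-α}` beat every geometric growth. -/
theorem summable_factorial_rpow_mul_pow {α : ℝ} (hα : 0 < α) {R : ℝ} (hR : 0 < R) :
    Summable fun i : ℕ => (i.factorial : ℝ) ^ (-α) * R ^ i := by
  refine summable_of_ratio_test_tendsto_lt_one (l := 0) one_pos
    (Eventually.of_forall fun i => by positivity) ?_
  have h : Tendsto (fun i : ℕ => ((i + 1 : ℕ) : ℝ) ^ (-α) * R) atTop (𝓝 (0 * R)) :=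
    (((tendsto_rpow_neg_atTop hα).comp tendsto_natCast_atTop_atTop).comp
      (tendsto_add_atTop_nat 1)).mul_const R
  rw [zero_mul] at h
  refine h.congr fun i => ?_
  have h1 : (0 : ℝ) < (i.factorial : ℝ) ^ (-α) := by positivity
  have h2 : (0 : ℝ) < ((i + 1 : ℕ) : ℝ) ^ (-α) := by positivity
  rw [Nat.factorial_succ, Nat.cast_mul, Real.mul_rpow (by positivity) (by positivity), pow_succ,
    Real.norm_of_nonneg (by positivity), Real.norm_of_nonneg (by positivity)]
  field_simp

/-- The entire series `∑ cᵢ (i!)^{-α} xⁱ`. -/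
noncomputable def factorialSeries (c : ℕ → ℝ) (α x : ℝ) : ℝ :=
  ∑' i : ℕ, c i * (i.factorial : ℝ) ^ (-α) * x ^ i

theorem summable_factorialSeries {c : ℕ → ℝ} (hc : ∀ i, |c i| ≤ 8 ^ i) {α : ℝ} (hα : 0 < α)
    (x : ℝ) : Summable fun i : ℕ => c i * (i.factorial : ℝ) ^ (-α) * x ^ i := by
  refine Summable.of_norm_bounded
    (summable_factorial_rpow_mul_pow hα (R := 8 * (|x| + 1)) (by positivity)) fun i => ?_
  have h1 : (0 : ℝ) < (i.factorial : ℝ) ^ (-α) := by positivity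
  rw [Real.norm_eq_abs, abs_mul, abs_mul, abs_of_pos h1, abs_pow, mul_pow]
  calc |c i| * (i.factorial : ℝ) ^ (-α) * |x| ^ i
      ≤ 8 ^ i * (i.factorial : ℝ) ^ (-α) * (|x| + 1) ^ i := by
        gcongr
        · exact hc i
        · linarith
    _ = _ := by ring

theorem hasStrictDerivAt_factorialSeries_one {c : ℕ → ℝ} (hc : ∀ i, |c i| ≤ 8 ^ i) {α : ℝ}
    (hα : 0 < α) :
    HasStrictDerivAt (factorialSeries c α) (factorialSeries (fun i => i * c i) α 1) 1 := by
  have hu := summable_factorial_rpow_mul_pow hα (R := 32) (by norm_num)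
  have hbound : ∀ (i : ℕ), ∀ y ∈ Metric.ball (0 : ℝ) 2,
      ‖c i * (i.factorial : ℝ) ^ (-α) * (i * y ^ (i - 1))‖
        ≤ (i.factorial : ℝ) ^ (-α) * 32 ^ i := by
    intro i y hy
    have h1 : (0 : ℝ) < (i.factorial : ℝ) ^ (-α) := by positivity
    have hy2 : |y| ≤ 2 := by simpa using (mem_ball_zero_iff.1 hy).le
    have hy3 : |y| ^ (i - 1) ≤ 2 ^ i :=
      (pow_le_pow_left₀ (abs_nonneg y) hy2 _).trans
        (pow_le_pow_right₀ (by norm_num) (Nat.sub_le i 1))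
    rw [Real.norm_eq_abs, abs_mul, abs_mul, abs_of_pos h1, abs_mul, abs_pow, Nat.abs_cast]
    calc |c i| * (i.factorial : ℝ) ^ (-α) * (i * |y| ^ (i - 1))
        ≤ 8 ^ i * (i.factorial : ℝ) ^ (-α) * (2 ^ i * 2 ^ i) := by
          gcongr
          · exact hc i
          · exact natCast_le_two_pow i
      _ = (i.factorial : ℝ) ^ (-α) * (8 * 2 * 2) ^ i := by rw [mul_pow, mul_pow]; ring
      _ = _ := by norm_num
  have hderiv : ∀ y ∈ Metric.ball (0 : ℝ) 2, HasDerivAt (factorialSeries c α)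
      (∑' i : ℕ, c i * (i.factorial : ℝ) ^ (-α) * (i * y ^ (i - 1))) y := fun y hy =>
    hasDerivAt_tsum_of_isPreconnected hu Metric.isOpen_ball
      (convex_ball (0 : ℝ) 2).isPreconnected
      (fun i y _ => (hasDerivAt_pow i y).const_mul _) hbound
      (Metric.mem_ball_self two_pos) (summable_factorialSeries hc hα 0) hy
  have hcont : ContinuousOn
      (fun y : ℝ => ∑' i : ℕ, c i * (i.factorial : ℝ) ^ (-α) * (i * y ^ (i - 1)))
      (Metric.ball (0 : ℝ) 2) :=
    continuousOn_tsum (fun i => by fun_prop) hu hbound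
  have hmem : Metric.ball (0 : ℝ) 2 ∈ 𝓝 (1 : ℝ) := Metric.isOpen_ball.mem_nhds (by simp)
  refine (hasStrictDerivAt_of_hasDerivAt_of_continuousAt
    (Filter.eventually_of_mem hmem hderiv) (hcont.continuousAt hmem)).congr_deriv ?_
  exact tsum_congr fun i => by rw [one_pow, one_pow]; ring

theorem continuousAt_factorialSeries_exponent {c : ℕ → ℝ} (hc : ∀ i, |c i| ≤ 8 ^ i) {α : ℝ}
    (hα : 0 < α) : ContinuousAt (fun a => factorialSeries c a 1) α := by
  have h : ContinuousOn (fun a => factorialSeries c a 1) (Set.Ioi (α / 2)) := by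
    refine continuousOn_tsum (fun i => ?_)
      (summable_factorial_rpow_mul_pow (half_pos hα) (R := 8) (by norm_num)) fun i a ha => ?_
    · have h0 : (i.factorial : ℝ) ≠ 0 := by positivity
      exact Continuous.continuousOn (by
        have := (Real.continuous_const_rpow h0).comp continuous_neg
        fun_prop)
    · have h0 : (1 : ℝ) ≤ i.factorial := by exact_mod_cast i.factorial_pos
      have h1 : (0 : ℝ) < (i.factorial : ℝ) ^ (-a) := by positivity
      rw [one_pow, mul_one, norm_mul, Real.norm_of_nonneg h1.le, mul_comm]
      exact mul_le_mul
        (Real.rpow_le_rpow_of_exponent_le h0 (by linarith [Set.mem_Ioi.1 ha])) (hc i)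
        (norm_nonneg _) (by positivity)
  exact h.continuousAt (Ioi_mem_nhds (by linarith))

theorem factorialSeries_one_pos {α x : ℝ} (hα : 0 < α) (hx : 0 < x) :
    0 < factorialSeries 1 α x := by
  have h := summable_factorialSeries abs_one_le_eight_pow hα x
  exact h.tsum_pos (fun i => by simp only [Pi.one_apply]; positivity) 0 (by simp)

theorem poissonP_rpow {l : ℝ} (hl : 0 < l) (α : ℝ) (i : ℕ) :
    poissonP l i ^ α = Real.exp (-(α * l)) * ((i.factorial : ℝ) ^ (-α) * (l ^ α) ^ i) := by
  have h0 : (0 : ℝ) < i.factorial := by positivity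
  rw [poissonP, Real.div_rpow (by positivity) h0.le, Real.mul_rpow (by positivity) (by positivity),
    ← Real.exp_mul, ← Real.rpow_natCast, ← Real.rpow_natCast, ← Real.rpow_mul hl.le,
    ← Real.rpow_mul hl.le, Real.rpow_neg h0.le, mul_comm (i : ℝ) α, neg_mul, mul_comm l α]
  ring

theorem log_poissonP {l : ℝ} (hl : 0 < l) (i : ℕ) :
    Real.log (poissonP l i) = -l + i * Real.log l - Real.log i.factorial := by
  rw [poissonP, Real.log_div (by positivity) (by positivity),
    Real.log_mul (by positivity) (by positivity), Real.log_exp, Real.log_pow]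

theorem genRenyi_poisson_eq {α l : ℝ} (hα : 0 < α) (hl : 0 < l) :
    -(∑' i, (poissonP l i) ^ α * Real.log (poissonP l i)) / psiPoisson α l =
      l - Real.log l * (factorialSeries (fun i => i) α (l ^ α) / factorialSeries 1 α (l ^ α))
        + factorialSeries (fun i => Real.log i.factorial) α (l ^ α)
          / factorialSeries 1 α (l ^ α) := by
  have hZ := factorialSeries_one_pos hα (Real.rpow_pos_of_pos hl α)
  have hpsi : psiPoisson α l = Real.exp (-(α * l)) * factorialSeries 1 α (l ^ α) := by
    rw [psiPoisson, factorialSeries, ← tsum_mul_left]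
    exact tsum_congr fun i => by rw [poissonP_rpow hl]; simp
  have hsum : HasSum (fun i => (poissonP l i) ^ α * Real.log (poissonP l i))
      (Real.exp (-(α * l)) * (-l * factorialSeries 1 α (l ^ α)
        + Real.log l * factorialSeries (fun i => i) α (l ^ α)
        - factorialSeries (fun i => Real.log i.factorial) α (l ^ α))) := by
    have h1 := (summable_factorialSeries abs_one_le_eight_pow hα (l ^ α)).hasSum
    have h2 := (summable_factorialSeries abs_natCast_le_eight_pow hα (l ^ α)).hasSum
    have h3 := (summable_factorialSeries abs_log_factorial_le_eight_pow hα (l ^ α)).hasSum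
    refine ((((h1.mul_left (-l)).add (h2.mul_left (Real.log l))).sub h3).mul_left
      (Real.exp (-(α * l)))).congr_fun fun i => ?_
    rw [poissonP_rpow hl, log_poissonP hl, Pi.one_apply]
    ring
  rw [hsum.tsum_eq, hpsi]
  have := Real.exp_pos (-(α * l))
  field_simp
  ring

/-- The derivative of the entropy at `λ = 1`. -/
noncomputable def entropySlope (α : ℝ) : ℝ :=
  1 - factorialSeries (fun i => i) α 1 / factorialSeries 1 α 1
    + α * (factorialSeries (fun i => i * Real.log i.factorial) α 1 * factorialSeries 1 α 1
        - factorialSeries (fun i => i) α 1 * factorialSeries (fun i => Real.log i.factorial) α 1)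
      / factorialSeries 1 α 1 ^ 2

theorem hasStrictDerivAt_genRenyi_poisson {α : ℝ} (hα : 0 < α) :
    HasStrictDerivAt (fun l : ℝ =>
      -(∑' i, (poissonP l i) ^ α * Real.log (poissonP l i)) / psiPoisson α l)
      (entropySlope α) 1 := by
  have hx : HasStrictDerivAt (fun l : ℝ => l ^ α) α 1 := by
    simpa using Real.hasStrictDerivAt_rpow_const (x := 1) (p := α) (Or.inl one_ne_zero)
  have hcomp : ∀ {c : ℕ → ℝ}, (∀ i, |c i| ≤ 8 ^ i) →
      HasStrictDerivAt (fun l : ℝ => factorialSeries c α (l ^ α))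
        (factorialSeries (fun i => i * c i) α 1 * α) 1 := fun {c} hc => by
    have h := hasStrictDerivAt_factorialSeries_one hc hα
    exact HasStrictDerivAt.comp (1 : ℝ) (by simpa using h) hx
  have hZ := hcomp abs_one_le_eight_pow
  have hA := hcomp abs_natCast_le_eight_pow
  have hL := hcomp abs_log_factorial_le_eight_pow
  have hpos := factorialSeries_one_pos hα one_pos
  have hne : factorialSeries 1 α ((1 : ℝ) ^ α) ≠ 0 := by simpa using hpos.ne'
  have hlog : HasStrictDerivAt Real.log 1 1 := by
    simpa using Real.hasStrictDerivAt_log one_ne_zero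
  have key := ((hasStrictDerivAt_id (1 : ℝ)).sub (hlog.mul (hA.div hZ hne))).add (hL.div hZ hne)
  have hmem : Set.Ioi (0 : ℝ) ∈ 𝓝 (1 : ℝ) := Ioi_mem_nhds one_pos
  refine (key.congr_of_eventuallyEq ?_).congr_deriv ?_
  · filter_upwards [hmem] with l hl
    exact (genRenyi_poisson_eq hα hl).symm
  · simp only [Real.one_rpow, Real.log_one, Pi.one_apply, Pi.div_apply, mul_one, entropySlope]
    field_simp
    ring

/-- A function with negative strict derivative is strictly decreasing nearby. -/
theorem HasStrictDerivAt.exists_strictAntiOn_Ioo {f : ℝ → ℝ} {f' x : ℝ}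
    (hf : HasStrictDerivAt f f' x) (hneg : f' < 0) :
    ∃ δ : ℝ, 0 < δ ∧ δ < 1 ∧ StrictAntiOn f (Set.Ioo (x - δ) (x + δ)) := by
  have h := hf.isLittleO.def (c := -f' / 2) (by linarith)
  rw [nhds_prod_eq] at h
  obtain ⟨t, ht, hst⟩ := (Filter.eventually_prod_self_iff (r := fun y z =>
    ‖f y - f z - (ContinuousLinearMap.toSpanSingleton ℝ f') (y - z)‖ ≤ -f' / 2 * ‖y - z‖)).1 h
  obtain ⟨ε, hε, hball⟩ := Metric.mem_nhds_iff.1 ht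
  have hmem : ∀ y ∈ Set.Ioo (x - min ε (1 / 2)) (x + min ε (1 / 2)), y ∈ t := fun y hy =>
    hball (by
      rw [Real.ball_eq_Ioo]
      exact ⟨by linarith [hy.1, min_le_left ε (1 / 2)], by linarith [hy.2, min_le_left ε (1 / 2)]⟩)
  refine ⟨min ε (1 / 2), by positivity, (min_le_right _ _).trans_lt (by norm_num), ?_⟩
  intro y hy z hz hyz
  have hb := hst z (hmem z hz) y (hmem y hy)
  simp only [Real.norm_eq_abs, abs_of_pos (sub_pos.2 hyz), smul_eq_mul,
    ContinuousLinearMap.toSpanSingleton_apply] at hb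
  have := (abs_le.1 hb).2
  nlinarith [mul_pos_of_neg_of_neg hneg (sub_neg.2 hyz)]

theorem continuousAt_entropySlope {α : ℝ} (hα : 0 < α) : ContinuousAt entropySlope α := by
  have hZ := continuousAt_factorialSeries_exponent abs_one_le_eight_pow hα
  have hA := continuousAt_factorialSeries_exponent abs_natCast_le_eight_pow hα
  have hL := continuousAt_factorialSeries_exponent abs_log_factorial_le_eight_pow hα
  have hB := continuousAt_factorialSeries_exponent abs_natCast_mul_log_factorial_le_eight_pow hα
  have hne := (factorialSeries_one_pos hα one_pos).ne'
  exact (continuousAt_const.sub (hA.div hZ hne)).add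
    ((continuousAt_id.mul ((hB.mul hZ).sub (hA.mul hL))).div (hZ.pow 2) (pow_ne_zero 2 hne))

/-- The integer parts of `10⁵ (i!)^{-1/10}` for `i < 50`. -/
def weightTable : List ℕ :=
  [100000, 100000, 93303, 83595, 72774, 61955, 51792, 42634, 34629, 27798, 22081, 17373, 13550,
   10485, 8053, 6142, 4655, 3506, 2626, 1956, 1450, 1069, 785, 573, 417, 302, 218, 157, 112, 80,
   57, 40, 28, 20, 14, 9, 6, 4, 3, 2, 1, 1, 0, 0, 0, 0, 0, 0, 0, 0]

/-- The integer parts of `10 log i!` for `i < 50`. -/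
def logTable : List ℕ :=
  [0, 0, 6, 17, 31, 47, 65, 85, 106, 128, 151, 175, 199, 225, 251, 278, 306, 335, 363, 393, 423,
   453, 484, 516, 547, 580, 612, 645, 678, 712, 746, 780, 815, 850, 885, 921, 957, 993, 1029,
   1066, 1103, 1140, 1177, 1215, 1253, 1291, 1329, 1368, 1406, 1445]

theorem weightTable_spec : ∀ i < 50,
    weightTable.getD i 0 ^ 10 * i.factorial ≤ 10 ^ 50 ∧
      10 ^ 50 ≤ (weightTable.getD i 0 + 1) ^ 10 * i.factorial := by
  decide +kernel

theorem logTable_spec : ∀ i < 50,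
    27182818286 ^ logTable.getD i 0 ≤ i.factorial ^ 10 * (10 ^ 10) ^ logTable.getD i 0 ∧
      i.factorial ^ 10 * (10 ^ 10) ^ (logTable.getD i 0 + 1)
        ≤ 27182818283 ^ (logTable.getD i 0 + 1) := by
  decide +kernel

theorem rpow_neg_one_tenth_pow {x : ℝ} (hx : 0 < x) : (x ^ (-(1 / 10 : ℝ))) ^ 10 = x⁻¹ := by
  rw [← Real.rpow_natCast, ← Real.rpow_mul hx.le, ← Real.rpow_neg_one]
  norm_num

theorem le_rpow_neg_one_tenth {x y : ℝ} (hx : 0 < x) (h : y ^ 10 * x ≤ 1) :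
    y ≤ x ^ (-(1 / 10 : ℝ)) := by
  refine le_of_pow_le_pow_left₀ (n := 10) (by norm_num) (by positivity) ?_
  rw [rpow_neg_one_tenth_pow hx]
  rwa [← one_div, le_div_iff₀ hx]

theorem rpow_neg_one_tenth_le {x y : ℝ} (hx : 0 < x) (hy : 0 ≤ y) (h : 1 ≤ y ^ 10 * x) :
    x ^ (-(1 / 10 : ℝ)) ≤ y := by
  refine le_of_pow_le_pow_left₀ (n := 10) (by norm_num) hy ?_
  rw [rpow_neg_one_tenth_pow hx, inv_le_iff_one_le_mul₀ hx]
  exact h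

theorem weightTable_le {i : ℕ} (hi : i < 50) :
    (weightTable.getD i 0 : ℝ) / 10 ^ 5 ≤ (i.factorial : ℝ) ^ (-(1 / 10 : ℝ)) := by
  have h : ((weightTable.getD i 0 : ℕ) : ℝ) ^ 10 * i.factorial ≤ 10 ^ 50 := by
    exact_mod_cast (weightTable_spec i hi).1
  refine le_rpow_neg_one_tenth (by positivity) ?_
  rw [div_pow, div_mul_eq_mul_div, div_le_one (by positivity), ← pow_mul]
  exact h

theorem le_weightTable {i : ℕ} (hi : i < 50) :
    (i.factorial : ℝ) ^ (-(1 / 10 : ℝ)) ≤ ((weightTable.getD i 0 : ℝ) + 1) / 10 ^ 5 := by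
  have h : (10 : ℝ) ^ 50 ≤ ((weightTable.getD i 0 : ℕ) + 1 : ℝ) ^ 10 * i.factorial := by
    exact_mod_cast (weightTable_spec i hi).2
  refine rpow_neg_one_tenth_le (by positivity) (by positivity) ?_
  rw [div_pow, div_mul_eq_mul_div, one_le_div (by positivity), ← pow_mul]
  exact h

theorem logTable_le {i : ℕ} (hi : i < 50) :
    (logTable.getD i 0 : ℝ) / 10 ≤ Real.log i.factorial := by
  have h0 := (logTable_spec i hi).1
  generalize logTable.getD i 0 = t at *
  have h1 : (27182818286 : ℝ) ^ t ≤ (i.factorial : ℝ) ^ 10 * (10 ^ 10) ^ t := by exact_mod_cast h0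
  have h2 : Real.exp t ≤ (i.factorial : ℝ) ^ 10 := by
    calc Real.exp t = Real.exp 1 ^ t := by rw [← Real.exp_nat_mul, mul_one]
      _ ≤ (27182818286 / 10 ^ 10 : ℝ) ^ t := by
        gcongr; exact Real.exp_one_lt_d9.le.trans (by norm_num)
      _ ≤ _ := by rwa [div_pow, div_le_iff₀ (by positivity)]
  have h3 := (Real.le_log_iff_exp_le (by positivity)).2 h2
  rw [Real.log_pow] at h3
  push_cast at h3
  linarith

theorem le_logTable {i : ℕ} (hi : i < 50) :
    Real.log i.factorial ≤ ((logTable.getD i 0 : ℝ) + 1) / 10 := by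
  have h0 := (logTable_spec i hi).2
  generalize logTable.getD i 0 = t at *
  have h1 : (i.factorial : ℝ) ^ 10 * (10 ^ 10) ^ (t + 1) ≤ (27182818283 : ℝ) ^ (t + 1) := by
    exact_mod_cast h0
  have h2 : (i.factorial : ℝ) ^ 10 ≤ Real.exp (t + 1 : ℕ) := by
    calc (i.factorial : ℝ) ^ 10 ≤ (27182818283 / 10 ^ 10 : ℝ) ^ (t + 1) := by
          rwa [div_pow, le_div_iff₀ (by positivity)]
      _ ≤ Real.exp 1 ^ (t + 1) := by
        gcongr; exact le_trans (by norm_num) Real.exp_one_gt_d9.le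
      _ = _ := by rw [← Real.exp_nat_mul, mul_one]
  have h3 := (Real.log_le_iff_le_exp (by positivity)).2 h2
  rw [Real.log_pow] at h3
  push_cast at h3
  linarith

theorem cube_mul_factorial_rpow_le (i : ℕ) :
    ((i + 50 : ℕ) : ℝ) ^ 3 * ((i + 50).factorial : ℝ) ^ (-(1 / 10 : ℝ))
      ≤ 1 / 20 * (3 / 4) ^ i := by
  induction i with
  | zero =>
    have h : (Nat.factorial (0 + 50) : ℝ) ^ (-(1 / 10 : ℝ)) ≤ 4 / 10 ^ 7 :=
      rpow_neg_one_tenth_le (by positivity) (by norm_num) (by norm_num [Nat.factorial])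
    norm_num at h ⊢
    linarith
  | succ i ih =>
    have hn : (50 : ℝ) ≤ ((i + 50 : ℕ) : ℝ) := by push_cast; linarith [Nat.cast_nonneg (α := ℝ) i]
    rw [show i + 1 + 50 = (i + 50) + 1 by ring, Nat.factorial_succ]
    generalize i + 50 = n at *
    have h1 : ((n + 1 : ℕ) : ℝ) ^ (-(1 / 10 : ℝ)) ≤ 7 / 10 := by
      refine rpow_neg_one_tenth_le (by positivity) (by norm_num) ?_
      push_cast
      linarith
    have h2 : ((n + 1 : ℕ) : ℝ) ^ 3 * (7 / 10) ≤ 3 / 4 * (n : ℝ) ^ 3 := by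
      push_cast
      nlinarith [mul_nonneg (sub_nonneg.2 hn) (sub_nonneg.2 hn), sq_nonneg (n : ℝ),
        mul_nonneg (sq_nonneg (n : ℝ)) (sub_nonneg.2 hn)]
    rw [Nat.cast_mul, Real.mul_rpow (by positivity) (by positivity)]
    calc ((n + 1 : ℕ) : ℝ) ^ 3 *
          (((n + 1 : ℕ) : ℝ) ^ (-(1 / 10 : ℝ)) * (n.factorial : ℝ) ^ (-(1 / 10 : ℝ)))
        ≤ ((n + 1 : ℕ) : ℝ) ^ 3 * (7 / 10 * (n.factorial : ℝ) ^ (-(1 / 10 : ℝ))) := by gcongr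
      _ = ((n + 1 : ℕ) : ℝ) ^ 3 * (7 / 10) * (n.factorial : ℝ) ^ (-(1 / 10 : ℝ)) := by ring
      _ ≤ 3 / 4 * (n : ℝ) ^ 3 * (n.factorial : ℝ) ^ (-(1 / 10 : ℝ)) := by gcongr
      _ = 3 / 4 * ((n : ℝ) ^ 3 * (n.factorial : ℝ) ^ (-(1 / 10 : ℝ))) := by ring
      _ ≤ 3 / 4 * (1 / 20 * (3 / 4) ^ i) := by gcongr
      _ = _ := by ring

theorem factorialSeries_one_tenth_le {c : ℕ → ℝ} (hc : ∀ i, |c i| ≤ 8 ^ i)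
    (hc3 : ∀ i, 50 ≤ i → c i ≤ (i : ℝ) ^ 3) {u : ℕ → ℕ} {q : ℕ}
    (hu : ∀ i < 50, c i * (i.factorial : ℝ) ^ (-(1 / 10 : ℝ)) ≤ u i / 10 ^ q) :
    factorialSeries c (1 / 10) 1 ≤ (∑ i ∈ Finset.range 50, u i : ℕ) / 10 ^ q + 1 / 5 := by
  have hs := summable_factorialSeries hc (α := 1 / 10) (by norm_num) 1
  have hgeo : HasSum (fun i : ℕ => 1 / 20 * (3 / 4 : ℝ) ^ i) (1 / 5) := by
    have := (hasSum_geometric_of_lt_one (r := (3 / 4 : ℝ)) (by norm_num) (by norm_num)).mul_left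
      (1 / 20)
    norm_num at this ⊢
    exact this
  rw [factorialSeries, ← hs.sum_add_tsum_nat_add 50, Nat.cast_sum, Finset.sum_div]
  refine add_le_add (Finset.sum_le_sum fun i hi => ?_) ?_
  · simpa only [one_pow, mul_one] using hu i (Finset.mem_range.1 hi)
  · rw [← hgeo.tsum_eq]
    refine ((summable_nat_add_iff 50).2 hs).tsum_le_tsum (fun i => ?_) hgeo.summable
    rw [one_pow, mul_one]
    refine le_trans ?_ (cube_mul_factorial_rpow_le i)
    gcongr
    exact hc3 _ (by omega)

theorem le_factorialSeries_one_tenth {c : ℕ → ℝ} (hc : ∀ i, |c i| ≤ 8 ^ i)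
    (hc0 : ∀ i, 0 ≤ c i) {u : ℕ → ℕ} {q : ℕ}
    (hu : ∀ i < 50, u i / 10 ^ q ≤ c i * (i.factorial : ℝ) ^ (-(1 / 10 : ℝ))) :
    ((∑ i ∈ Finset.range 50, u i : ℕ) : ℝ) / 10 ^ q ≤ factorialSeries c (1 / 10) 1 := by
  have hs := summable_factorialSeries hc (α := 1 / 10) (by norm_num) 1
  rw [Nat.cast_sum, Finset.sum_div]
  refine (Finset.sum_le_sum fun i hi => ?_).trans
    (hs.sum_le_tsum (Finset.range 50) fun i _ => ?_)
  · simpa only [one_pow, mul_one] using hu i (Finset.mem_range.1 hi)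
  · have := hc0 i
    positivity

theorem factorialSeries_one_one_tenth_le : factorialSeries 1 (1 / 10) 1 ≤ 7.85 := by
  have h := factorialSeries_one_tenth_le abs_one_le_eight_pow (q := 5)
    (u := fun i => weightTable.getD i 0 + 1)
    (fun i hi => by
      have : (1 : ℝ) ≤ i := by exact_mod_cast (by omega : 1 ≤ i)
      simpa using one_le_pow₀ this)
    (fun i hi => by simpa using le_weightTable hi)
  have hsum : ∑ i ∈ Finset.range 50, (weightTable.getD i 0 + 1) ≤ 765000 := by decide +kernel
  have hsum' : ((∑ i ∈ Finset.range 50, (weightTable.getD i 0 + 1) : ℕ) : ℝ) ≤ 765000 := by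
    exact_mod_cast hsum
  linarith

theorem le_factorialSeries_natCast_one_tenth :
    35.29 ≤ factorialSeries (fun i => i) (1 / 10) 1 := by
  have h := le_factorialSeries_one_tenth abs_natCast_le_eight_pow (q := 5)
    (u := fun i => i * weightTable.getD i 0) (fun i => i.cast_nonneg)
    (fun i hi => by
      push_cast
      rw [mul_div_assoc]
      gcongr
      exact weightTable_le hi)
  have hsum : 3529000 ≤ ∑ i ∈ Finset.range 50, i * weightTable.getD i 0 := by decide +kernel
  have hsum' : (3529000 : ℝ) ≤ (∑ i ∈ Finset.range 50, i * weightTable.getD i 0 : ℕ) := by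
    exact_mod_cast hsum
  linarith

theorem le_factorialSeries_log_one_tenth :
    43.54 ≤ factorialSeries (fun i => Real.log i.factorial) (1 / 10) 1 := by
  have h := le_factorialSeries_one_tenth abs_log_factorial_le_eight_pow (q := 6)
    (u := fun i => logTable.getD i 0 * weightTable.getD i 0) log_factorial_nonneg
    (fun i hi => by
      push_cast
      calc ((logTable.getD i 0 : ℝ) * weightTable.getD i 0) / 10 ^ 6
          = logTable.getD i 0 / 10 * (weightTable.getD i 0 / 10 ^ 5) := by ring
        _ ≤ _ := mul_le_mul (logTable_le hi) (weightTable_le hi) (by positivity)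
          (log_factorial_nonneg i))
  have hsum : 43540000 ≤ ∑ i ∈ Finset.range 50, logTable.getD i 0 * weightTable.getD i 0 := by
    decide +kernel
  have hsum' : (43540000 : ℝ) ≤
      (∑ i ∈ Finset.range 50, logTable.getD i 0 * weightTable.getD i 0 : ℕ) := by
    exact_mod_cast hsum
  linarith

theorem factorialSeries_mul_log_one_tenth_le :
    factorialSeries (fun i => i * Real.log i.factorial) (1 / 10) 1 ≤ 461.4 := by
  have h := factorialSeries_one_tenth_le abs_natCast_mul_log_factorial_le_eight_pow (q := 6)
    (u := fun i => i * (logTable.getD i 0 + 1) * (weightTable.getD i 0 + 1))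
    (fun i _ => by
      calc (i : ℝ) * Real.log i.factorial ≤ i * (i : ℝ) ^ 2 := by
            gcongr; exact log_factorial_le_sq i
        _ = (i : ℝ) ^ 3 := by ring)
    (fun i hi => by
      push_cast
      calc (i : ℝ) * Real.log i.factorial * (i.factorial : ℝ) ^ (-(1 / 10 : ℝ))
          ≤ i * (((logTable.getD i 0 : ℝ) + 1) / 10)
            * (((weightTable.getD i 0 : ℝ) + 1) / 10 ^ 5) := by
            gcongr
            · exact le_logTable hi
            · exact le_weightTable hi
        _ = _ := by ring)
  have hsum : ∑ i ∈ Finset.range 50, i * (logTable.getD i 0 + 1) * (weightTable.getD i 0 + 1)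
      ≤ 461200000 := by decide +kernel
  have hsum' : ((∑ i ∈ Finset.range 50,
      i * (logTable.getD i 0 + 1) * (weightTable.getD i 0 + 1) : ℕ) : ℝ) ≤ 461200000 := by
    exact_mod_cast hsum
  linarith

theorem entropySlope_one_tenth_neg : entropySlope (1 / 10) < 0 := by
  have hpos := factorialSeries_one_pos (α := 1 / 10) (by norm_num) one_pos
  have hZ := factorialSeries_one_one_tenth_le
  have hA := le_factorialSeries_natCast_one_tenth
  have hL := le_factorialSeries_log_one_tenth
  have hB := factorialSeries_mul_log_one_tenth_le
  rw [entropySlope]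
  generalize factorialSeries 1 (1 / 10) 1 = Z at *
  generalize factorialSeries (fun i => (i : ℝ)) (1 / 10) 1 = A at *
  generalize factorialSeries (fun i => Real.log i.factorial) (1 / 10) 1 = L at *
  generalize factorialSeries (fun i => i * Real.log i.factorial) (1 / 10) 1 = B at *
  have hAL : 35.29 * 43.54 ≤ A * L := mul_le_mul hA hL (by norm_num) (by linarith)
  have hmain : Z * (Z - A + B / 10) ≤ Z * 18.7 := by gcongr; linarith
  have heq : 1 - A / Z + 1 / 10 * (B * Z - A * L) / Z ^ 2
      = (Z * (Z - A + B / 10) - A * L / 10) / Z ^ 2 := by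
    field_simp
    ring
  rw [heq]
  exact div_neg_of_neg_of_pos (by linarith) (by positivity)

/-- "anomalous" behavior of the one-parameter generalized Rényi
entropy of the Poisson distribution: for α in some interval (a,b) ⊂ (0,1), the
entropy is strictly decreasing in λ on a neighborhood of λ = 1. -/
theorem genRenyi1_poisson_anomalous :
    ∃ a b : ℝ, 0 < a ∧ a < b ∧ b < 1 ∧
      ∀ α ∈ Set.Ioo a b, ∃ δ : ℝ, 0 < δ ∧ δ < 1 ∧
        StrictAntiOn
          (fun l : ℝ =>
            -(∑' i, (poissonP l i) ^ α * Real.log (poissonP l i)) / psiPoisson α l)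
          (Set.Ioo (1 - δ) (1 + δ)) := by
  have hev : ∀ᶠ α in 𝓝 (1 / 10 : ℝ), entropySlope α < 0 :=
    (continuousAt_entropySlope (by norm_num)).eventually_lt_const entropySlope_one_tenth_neg
  obtain ⟨a, b, ⟨ha, hb⟩, hsub⟩ := mem_nhds_iff_exists_Ioo_subset.1
    (Filter.inter_mem hev (Ioo_mem_nhds (a := 1 / 20) (b := 1 / 2) (by norm_num) (by norm_num)))
  have hab := ha.trans hb
  obtain ⟨h1, h2⟩ := (Set.Ioo_subset_Ioo_iff hab).1 (hsub.trans Set.inter_subset_right)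
  refine ⟨a, b, by linarith, hab, by linarith, fun α hα => ?_⟩
  exact (hasStrictDerivAt_genRenyi_poisson (by linarith [hα.1])).exists_strictAntiOn_Ioo
    (hsub hα).1
end
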